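/- Let m ≥ 0, α > 0 and τ ≥ 0. For every w ∈ L²(m) there exists a unique ω ∈ L²(m) solving the scaled Helmholtz equation ω - α² e^{-τ} Δω = w in the sense of distributions (i.e. ∫ ω (φ - α² e^{-τ} Δφ) dξ = ∫ w φ dξ for all φ ∈ C_c^∞(ℝ²)); moreover there is a constant C = C(m,α) > 0, independent of τ and w, such that ‖ω‖_m ≤ C ‖w‖_m. -/

import Mathlib

open MeasureTheory Real ENNReal

noncomputable section

abbrev E2 := EuclideanSpace ℝ (Fin 2)

def e (i : Fin 2) : E2 := EuclideanSpace.single i 1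

/-- Partial derivative in the `i`-th coordinate direction. -/
def pd (i : Fin 2) (f : E2 → ℝ) (x : E2) : ℝ := fderiv ℝ f x (e i)

/-- The Laplacian on `ℝ²`. -/
def lap (f : E2 → ℝ) (x : E2) : ℝ := ∑ i : Fin 2, pd i (pd i f) x

/-- The weighted norm `‖f‖_m = (∫ (1+|ξ|²)^m |f(ξ)|² dξ)^{1/2}`, valued in `ℝ≥0∞`. -/
def wnorm (m : ℝ) (f : E2 → ℝ) : ℝ≥0∞ :=
  (∫⁻ ξ, ENNReal.ofReal ((1 + ‖ξ‖ ^ 2) ^ m) * (‖f ξ‖₊ : ℝ≥0∞) ^ 2) ^ (1 / 2 : ℝ)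

/-- `ω` solves the scaled Helmholtz equation `ω - α² e^{-τ} Δω = w` in the sense of
distributions. -/
def SolvesScaledHelmholtz (α τ : ℝ) (ω w : E2 → ℝ) : Prop :=
  ∀ φ : E2 → ℝ, ContDiff ℝ (⊤ : ℕ∞) φ → HasCompactSupport φ →
    ∫ ξ, ω ξ * (φ ξ - α ^ 2 * Real.exp (-τ) * lap φ ξ) = ∫ ξ, w ξ * φ ξ


open Set ProbabilityTheory SchwartzMap FourierTransform LineDeriv Laplacian

def nuExp : Measure ℝ :=
  (volume.restrict (Ioi (0:ℝ))).withDensity (fun s => ENNReal.ofReal (Real.exp (-s)))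

instance : IsProbabilityMeasure nuExp := by
  constructor
  rw [nuExp, withDensity_apply _ MeasurableSet.univ, Measure.restrict_univ,
    ← ofReal_integral_eq_lintegral_ofReal (integrableOn_exp_neg_Ioi 0)
      (Filter.Eventually.of_forall fun _ => (Real.exp_pos _).le), integral_exp_neg_Ioi_zero]
  simp

lemma nuExp_integral {F : Type*} [NormedAddCommGroup F] [NormedSpace ℝ F] (f : ℝ → F) :
    ∫ s, f s ∂nuExp = ∫ s in Ioi (0:ℝ), Real.exp (-s) • f s := by
  rw [nuExp, integral_withDensity_eq_integral_toReal_smul (by fun_prop) (by simp)]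
  simp [(Real.exp_pos _).le]

lemma nuExp_pow (n : ℕ) : Integrable (fun s : ℝ => (√(2 * s)) ^ (2 * n)) nuExp := by
  have h1 : Integrable (fun s : ℝ => Real.exp (-s) * s ^ n) (volume.restrict (Ioi 0)) := by
    have := Real.GammaIntegral_convergent (s := n + 1) (by positivity)
    refine this.congr_fun (fun x hx => ?_) measurableSet_Ioi
    simp
  rw [nuExp, integrable_withDensity_iff (by fun_prop) (by simp)]
  have h2 := h1.const_mul (2 ^ n)
  refine h2.congr ?_
  filter_upwards [self_mem_ae_restrict measurableSet_Ioi] with s hs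
  have hs' : 0 ≤ 2 * s := by have : 0 < s := hs; linarith
  rw [pow_mul, Real.sq_sqrt hs', ENNReal.toReal_ofReal (Real.exp_pos _).le]
  ring

def muOne : Measure E2 :=
  (nuExp.prod (stdGaussian E2)).map (fun p : ℝ × E2 => √(2 * p.1) • p.2)

lemma meas_sm : Measurable (fun p : ℝ × E2 => √(2 * p.1) • p.2) := by fun_prop

instance : IsProbabilityMeasure muOne :=
  Measure.isProbabilityMeasure_map meas_sm.aemeasurable

lemma charFun_muOne (t : E2) : charFun muOne t = ((1 / (1 + ‖t‖ ^ 2) : ℝ) : ℂ) := by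
  rw [charFun_apply, muOne, integral_map meas_sm.aemeasurable
    (Measurable.aestronglyMeasurable (by fun_prop)), integral_prod]
  · have h (s : ℝ) : ∫ y : E2, Complex.exp (((inner ℝ (√(2 * s) • y) t : ℝ) : ℂ) * Complex.I)
        ∂(stdGaussian E2) = ((Real.exp (-(√(2*s)) ^ 2 * ‖t‖ ^ 2 / 2) : ℝ) : ℂ) := by
      have := charFun_stdGaussian (E := E2) (√(2 * s) • t)
      rw [charFun_apply] at this
      simp only [inner_smul_left, inner_smul_right] at this ⊢
      simp only [conj_trivial]
      rw [this, norm_smul, Real.norm_of_nonneg (Real.sqrt_nonneg _)]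
      push_cast
      congr 1; ring
    simp only [h]
    rw [integral_complex_ofReal, nuExp_integral]
    congr 1
    have h3 : ∀ s ∈ Ioi (0:ℝ), Real.exp (-s) • Real.exp (-(√(2*s)) ^ 2 * ‖t‖ ^ 2 / 2)
        = Real.exp (-(1 + ‖t‖ ^ 2) * s) := by
      intro s hs
      have : 0 < s := hs
      rw [Real.sq_sqrt (by linarith), smul_eq_mul, ← Real.exp_add]
      congr 1; ring
    rw [setIntegral_congr_fun measurableSet_Ioi h3, integral_exp_mul_Ioi (by nlinarith [sq_nonneg ‖t‖])]
    have : 1 + ‖t‖ ^ 2 ≠ 0 := by positivity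
    rw [mul_zero, Real.exp_zero, neg_div_neg_eq]
  · refine Integrable.of_bound (C := 1) (Measurable.aestronglyMeasurable (by fun_prop)) ?_
    refine Filter.Eventually.of_forall fun p => ?_
    rw [Complex.norm_exp_ofReal_mul_I]

lemma muOne_pow (n : ℕ) : Integrable (fun y : E2 => ‖y‖ ^ (2 * n)) muOne := by
  rw [muOne, integrable_map_measure (Measurable.aestronglyMeasurable (by fun_prop))
    meas_sm.aemeasurable]
  have h := (nuExp_pow n).mul_prod (ν := stdGaussian E2) (g := fun y => ‖y‖ ^ (2 * n)) 
    ((IsGaussian.memLp_id (stdGaussian E2) ((2 * n : ℕ) : ℝ≥0∞) (ENNReal.natCast_ne_top _)).integrable_norm_pow')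
  refine h.congr (Filter.Eventually.of_forall fun p => ?_)
  simp [norm_smul, mul_pow, abs_of_nonneg (Real.sqrt_nonneg _)]

lemma muOne_moment (m c : ℝ) (hc : 0 ≤ c) :
    ∫⁻ y, ENNReal.ofReal ((1 + c * ‖y‖ ^ 2) ^ m) ∂muOne < ⊤ := by
  obtain ⟨n, hn⟩ := exists_nat_ge m
  have hi : Integrable (fun y : E2 => 2 ^ n * (1 + c ^ n * ‖y‖ ^ (2 * n))) muOne :=
    ((integrable_const 1).add ((muOne_pow n).const_mul _)).const_mul _
  refine lt_of_le_of_lt (lintegral_mono fun y => ENNReal.ofReal_le_ofReal ?_) hi.lintegral_lt_top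
  have h0 : 0 ≤ c * ‖y‖ ^ 2 := by positivity
  calc (1 + c * ‖y‖ ^ 2) ^ m ≤ (1 + c * ‖y‖ ^ 2) ^ (n : ℝ) :=
        Real.rpow_le_rpow_of_exponent_le (by linarith) hn
    _ = (1 + c * ‖y‖ ^ 2) ^ n := Real.rpow_natCast _ _
    _ ≤ 2 ^ n * (1 ^ n + (c * ‖y‖ ^ 2) ^ n) := by
        refine (add_pow_le zero_le_one h0 n).trans ?_
        gcongr <;> norm_num
    _ = _ := by rw [mul_pow, pow_mul]; simp


lemma contDiff_pd (i : Fin 2) {φ : E2 → ℝ} (h : ContDiff ℝ (⊤ : ℕ∞) φ) :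
    ContDiff ℝ (⊤ : ℕ∞) (pd i φ) := by
  unfold pd
  exact (h.fderiv_right (m := (⊤ : ℕ∞)) (by simp)).clm_apply contDiff_const

lemma hcs_pd (i : Fin 2) {φ : E2 → ℝ} (h : HasCompactSupport φ) :
    HasCompactSupport (pd i φ) := h.fderiv_apply (𝕜 := ℝ) (e i)

lemma contDiff_lap {φ : E2 → ℝ} (h : ContDiff ℝ (⊤ : ℕ∞) φ) :
    ContDiff ℝ (⊤ : ℕ∞) (lap φ) := by
  unfold lap
  exact ContDiff.sum fun i _ => contDiff_pd i (contDiff_pd i h)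

lemma hcs_lap {φ : E2 → ℝ} (h : HasCompactSupport φ) :
    HasCompactSupport (lap φ) := by
  have : lap φ = pd 0 (pd 0 φ) + pd 1 (pd 1 φ) := by ext x; simp [lap]
  rw [this]
  exact (hcs_pd 0 (hcs_pd 0 h)).add (hcs_pd 1 (hcs_pd 1 h))

lemma fderiv_ofReal (f : E2 → ℝ) (h : Differentiable ℝ f) (x v : E2) :
    fderiv ℝ (fun y => ((f y : ℝ) : ℂ)) x v = ((fderiv ℝ f x v : ℝ) : ℂ) := by
  have := (Complex.ofRealCLM.hasFDerivAt (x := f x)).comp x (h x).hasFDerivAt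
  have h2 : fderiv ℝ (fun y => ((f y : ℝ) : ℂ)) x = Complex.ofRealCLM.comp (fderiv ℝ f x) :=
    this.fderiv
  rw [h2]; simp

def toS (φ : E2 → ℝ) (h : ContDiff ℝ (⊤ : ℕ∞) φ) (hc : HasCompactSupport φ) : 𝓢(E2, ℂ) :=
  HasCompactSupport.toSchwartzMap (f := fun x => ((φ x : ℝ) : ℂ))
    (hc.comp_left (g := fun r : ℝ => (r : ℂ)) (by simp)) (Complex.ofRealCLM.contDiff.comp h)

lemma toS_apply (φ : E2 → ℝ) (h hc) (x) : toS φ h hc x = ((φ x : ℝ) : ℂ) := rfl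

lemma toS_pd (φ : E2 → ℝ) (h hc) (i : Fin 2) :
    ∂_{e i} (toS φ h hc) = toS (pd i φ) (contDiff_pd i h) (hcs_pd i hc) := by
  ext x
  rw [lineDerivOp_apply_eq_fderiv, toS_apply]
  exact fderiv_ofReal φ (h.differentiable (by simp)) x (e i)

lemma toS_lap (φ : E2 → ℝ) (h hc) (x : E2) :
    (Δ (toS φ h hc)) x = ((lap φ x : ℝ) : ℂ) := by
  rw [SchwartzMap.laplacian_eq_sum (EuclideanSpace.basisFun (Fin 2) ℝ)]
  have : ∀ i, (EuclideanSpace.basisFun (Fin 2) ℝ) i = e i := by intro i; simp [e]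
  simp only [this, toS_pd, sum_apply, toS_apply, lap]
  push_cast; rfl

lemma fourier_lap (Φ : 𝓢(E2, ℂ)) (k : E2) :
    (𝓕 (Δ Φ)) k = -(((2 * π) ^ 2 * ‖k‖ ^ 2 : ℝ) : ℂ) * (𝓕 Φ) k := by
  rw [SchwartzMap.laplacian_eq_fourierMultiplierCLM]
  rw [FourierTransform.fourier_smul, fourierMultiplierCLM_apply, FourierTransform.fourier_fourierInv_eq]
  rw [_root_.smul_apply, smulLeftCLM_apply_apply (by fun_prop)]
  simp [mul_assoc]

lemma key (μ : Measure E2) [IsProbabilityMeasure μ] (ε : ℝ) (hε : 0 ≤ ε)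
    (hμ : ∀ t, charFun μ t = ((1 / (1 + ε * ‖t‖ ^ 2) : ℝ) : ℂ))
    (φ : E2 → ℝ) (h : ContDiff ℝ (⊤ : ℕ∞) φ) (hc : HasCompactSupport φ) (x : E2) :
    ∫ y, (φ (x + y) - ε * lap φ (x + y)) ∂μ = φ x := by
  set Φ := toS φ h hc with hΦ
  set g : 𝓢(E2, ℂ) := Φ - (ε : ℂ) • Δ Φ with hg
  have hgx : ∀ z, g z = ((φ z - ε * lap φ z : ℝ) : ℂ) := by
    intro z
    rw [hg, _root_.sub_apply, _root_.smul_apply, toS_lap, toS_apply]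
    push_cast; rfl
  have hFg : ∀ k, (𝓕 g) k = (((1 + ε * ((2 * π) ^ 2 * ‖k‖ ^ 2)) : ℝ) : ℂ) * (𝓕 Φ) k := by
    intro k
    rw [hg, sub_eq_add_neg, FourierTransform.fourier_add, FourierTransform.fourier_neg,
      FourierTransform.fourier_smul, ← sub_eq_add_neg,
      _root_.sub_apply, _root_.smul_apply, fourier_lap]
    push_cast
    simp only [smul_eq_mul]; ring
  have inv : ∀ (G : 𝓢(E2, ℂ)) z, G z = ∫ k, Complex.exp (((2 * π * inner ℝ k z : ℝ) : ℂ) * Complex.I) * (𝓕 G) k := by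
    intro G z
    conv_lhs => rw [← FourierTransform.fourierInv_fourier_eq (F := 𝓢(E2, ℂ)) G]
    rw [SchwartzMap.fourierInv_coe, Real.fourierInv_eq']
    simp
  have main : ∫ y, g (x + y) ∂μ = Φ x := by
    rw [inv Φ x]
    simp_rw [inv g]
    rw [integral_integral_swap]
    · congr 1
      ext k
      have : ∀ y, Complex.exp (((2 * π * inner ℝ k (x + y) : ℝ) : ℂ) * Complex.I) * (𝓕 g) k
          = (Complex.exp (((2 * π * inner ℝ k x : ℝ) : ℂ) * Complex.I) * (𝓕 g) k) *
            Complex.exp (((inner ℝ y ((2 * π) • k) : ℝ) : ℂ) * Complex.I) := by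
        intro y
        rw [inner_add_right, inner_smul_right, real_inner_comm k y, mul_add]
        push_cast
        rw [add_mul, Complex.exp_add]; ring
      simp_rw [this]
      rw [integral_const_mul, ← charFun_apply, hμ, hFg, norm_smul]
      have h1 : (1 + ε * ((2 * π) ^ 2 * ‖k‖ ^ 2)) ≠ 0 := by positivity
      rw [Real.norm_of_nonneg (by positivity), mul_pow (2 * π) ‖k‖]
      have h3 : (((1 + ε * ((2 * π) ^ 2 * ‖k‖ ^ 2)) : ℝ) : ℂ) *
          ((1 / (1 + ε * ((2 * π) ^ 2 * ‖k‖ ^ 2)) : ℝ) : ℂ) = 1 := by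
        rw [← Complex.ofReal_mul, mul_one_div_cancel h1, Complex.ofReal_one]
      linear_combination (Complex.exp (((2 * π * inner ℝ k x : ℝ) : ℂ) * Complex.I) * (𝓕 Φ) k) * h3
    · have : Integrable (fun p : E2 × E2 => (𝓕 g) p.2) (μ.prod volume) :=
        (𝓕 g).integrable.comp_snd μ
      refine this.bdd_mul (c := 1) (Continuous.aestronglyMeasurable (by fun_prop)) ?_
      refine Filter.Eventually.of_forall fun p => ?_
      rw [Complex.norm_exp_ofReal_mul_I]
  simp_rw [hgx] at main
  rw [integral_complex_ofReal, hΦ, toS_apply] at main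
  exact_mod_cast main

def W (m : ℝ) (f : E2 → ℝ) : ℝ≥0∞ :=
  ∫⁻ ξ, ENNReal.ofReal ((1 + ‖ξ‖ ^ 2) ^ m) * (‖f ξ‖₊ : ℝ≥0∞) ^ 2

lemma wnorm_eq (m : ℝ) (f : E2 → ℝ) : wnorm m f = W m f ^ (1 / 2 : ℝ) := rfl

lemma wnorm_lt_top {m : ℝ} {f : E2 → ℝ} : wnorm m f < ⊤ ↔ W m f < ⊤ := by
  rw [wnorm_eq, ENNReal.rpow_lt_top_iff_of_pos (by norm_num)]

lemma memLp_of_W {m : ℝ} (hm : 0 ≤ m) {f : E2 → ℝ} (hf : Measurable f) (h : W m f < ⊤) :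
    MemLp f 2 volume := by
  refine ⟨hf.aestronglyMeasurable, ?_⟩
  rw [eLpNorm_lt_top_iff_lintegral_rpow_enorm_lt_top (by norm_num) (by norm_num)]
  refine lt_of_le_of_lt (lintegral_mono fun x => ?_) h
  have h1 : (1 : ℝ≥0∞) ≤ ENNReal.ofReal ((1 + ‖x‖ ^ 2) ^ m) := by
    rw [← ENNReal.ofReal_one]
    exact ENNReal.ofReal_le_ofReal (Real.one_le_rpow (by nlinarith [sq_nonneg ‖x‖]) hm)
  calc ‖f x‖ₑ ^ (2 : ℝ≥0∞).toReal = 1 * (‖f x‖₊ : ℝ≥0∞) ^ 2 := by simp [enorm]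
    _ ≤ _ := by gcongr

lemma peetre (m : ℝ) (hm : 0 ≤ m) (x y : E2) :
    (1 + ‖x + y‖ ^ 2) ^ m ≤ 2 ^ m * (1 + ‖y‖ ^ 2) ^ m * (1 + ‖x‖ ^ 2) ^ m := by
  rw [← Real.mul_rpow (by positivity) (by positivity),
    ← Real.mul_rpow (by positivity) (by positivity)]
  refine Real.rpow_le_rpow (by positivity) ?_ hm
  have h1 := norm_add_le x y
  have h2 : ‖x + y‖ ^ 2 ≤ (‖x‖ + ‖y‖) ^ 2 := by gcongr
  nlinarith [sq_nonneg (‖x‖ - ‖y‖), mul_nonneg (sq_nonneg ‖x‖) (sq_nonneg ‖y‖)]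

lemma jensen (μ : Measure E2) [IsProbabilityMeasure μ] (f : E2 → ℝ) (hf : Measurable f) :
    (‖∫ y, f y ∂μ‖₊ : ℝ≥0∞) ^ 2 ≤ ∫⁻ y, (‖f y‖₊ : ℝ≥0∞) ^ 2 ∂μ := by
  have h1 : (‖∫ y, f y ∂μ‖₊ : ℝ≥0∞) ≤ eLpNorm f 1 μ := by
    rw [eLpNorm_one_eq_lintegral_enorm]
    exact enorm_integral_le_lintegral_enorm f
  have h2 := eLpNorm_le_eLpNorm_of_exponent_le (μ := μ) (p := 1) (q := 2) (by norm_num)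
    hf.aestronglyMeasurable
  have h3 : eLpNorm f 2 μ ^ 2 = ∫⁻ y, (‖f y‖₊ : ℝ≥0∞) ^ 2 ∂μ := by
    rw [eLpNorm_eq_lintegral_rpow_enorm_toReal (by norm_num) (by norm_num), ← ENNReal.rpow_natCast,
      ← ENNReal.rpow_mul]
    simp [enorm]
  rw [← h3]
  gcongr
  exact h1.trans h2

lemma W_conv (m : ℝ) (hm : 0 ≤ m) (μ : Measure E2) [IsProbabilityMeasure μ] (w : E2 → ℝ)
    (hw : Measurable w) :
    W m (fun x => ∫ y, w (x - y) ∂μ) ≤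
      ENNReal.ofReal (2 ^ m) * (∫⁻ y, ENNReal.ofReal ((1 + ‖y‖ ^ 2) ^ m) ∂μ) * W m w := by
  have hmeas : Measurable (fun x : E2 => ENNReal.ofReal ((1 + ‖x‖ ^ 2) ^ m)) := by fun_prop
  calc W m (fun x => ∫ y, w (x - y) ∂μ)
      ≤ ∫⁻ x, ∫⁻ y, ENNReal.ofReal ((1 + ‖x‖ ^ 2) ^ m) * (‖w (x - y)‖₊ : ℝ≥0∞) ^ 2 ∂μ := by
        refine lintegral_mono fun x => ?_
        rw [lintegral_const_mul _ (by fun_prop)]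
        gcongr
        exact jensen μ (fun y => w (x - y)) (by fun_prop)
    _ = ∫⁻ y, ∫⁻ x, ENNReal.ofReal ((1 + ‖x‖ ^ 2) ^ m) * (‖w (x - y)‖₊ : ℝ≥0∞) ^ 2 ∂volume ∂μ :=
        lintegral_lintegral_swap (Measurable.aemeasurable (by fun_prop))
    _ = ∫⁻ y, ∫⁻ x, ENNReal.ofReal ((1 + ‖x + y‖ ^ 2) ^ m) * (‖w x‖₊ : ℝ≥0∞) ^ 2 ∂volume ∂μ := by
        refine lintegral_congr fun y => ?_
        rw [← lintegral_add_right_eq_self _ y]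
        simp
    _ ≤ ∫⁻ y, ∫⁻ x, (ENNReal.ofReal (2 ^ m) * ENNReal.ofReal ((1 + ‖y‖ ^ 2) ^ m)) *
          (ENNReal.ofReal ((1 + ‖x‖ ^ 2) ^ m) * (‖w x‖₊ : ℝ≥0∞) ^ 2) ∂volume ∂μ := by
        refine lintegral_mono fun y => lintegral_mono fun x => ?_
        rw [← mul_assoc, ← ENNReal.ofReal_mul (by positivity), ← ENNReal.ofReal_mul (by positivity)]
        gcongr
        exact peetre m hm x y
    _ = _ := by
        simp_rw [lintegral_const_mul' _ _ (ENNReal.mul_ne_top ENNReal.ofReal_ne_top ENNReal.ofReal_ne_top)]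
        rw [lintegral_mul_const _ (by fun_prop), lintegral_const_mul _ (by fun_prop)]
        rfl

lemma pair_int (μ : Measure E2) [IsProbabilityMeasure μ] {u g : E2 → ℝ} (hu : MemLp u 2 volume)
    (hg : MemLp g 2 volume) :
    Integrable (fun p : E2 × E2 => u p.1 * g (p.1 + p.2)) ((volume : Measure E2).prod μ) := by
  have h1 : MemLp (fun p : E2 × E2 => u p.1) 2 ((volume : Measure E2).prod μ) :=
    hu.comp_measurePreserving measurePreserving_fst
  have h2 : MemLp (fun p : E2 × E2 => g (p.1 + p.2)) 2 ((volume : Measure E2).prod μ) :=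
    hg.comp_measurePreserving (measurePreserving_fst.comp (measurePreserving_add_prod volume μ))
  exact h1.integrable_mul h2

lemma pair_int' (μ : Measure E2) [IsProbabilityMeasure μ] {u g : E2 → ℝ} (hu : MemLp u 2 volume)
    (hg : MemLp g 2 volume) :
    Integrable (fun p : E2 × E2 => u (p.1 - p.2) * g p.1) ((volume : Measure E2).prod μ) := by
  have h := (measurePreserving_sub_prod (volume : Measure E2) μ).integrable_comp_of_integrable
    (pair_int μ hu hg)
  simpa [Function.comp_def] using h

lemma conv_pair (μ : Measure E2) [IsProbabilityMeasure μ] {u g : E2 → ℝ} (hu : MemLp u 2 volume)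
    (hg : MemLp g 2 volume) :
    ∫ x, (∫ y, u (x - y) ∂μ) * g x = ∫ x, u x * ∫ y, g (x + y) ∂μ := by
  simp_rw [← integral_mul_const, ← integral_const_mul]
  refine (integral_integral_swap (pair_int' μ hu hg)).trans
    (Eq.trans ?_ (integral_integral_swap (pair_int μ hu hg)).symm)
  congr 1; ext y
  rw [← integral_add_right_eq_self _ y]
  simp

lemma memLp_g (ε : ℝ) {φ : E2 → ℝ} (h : ContDiff ℝ (⊤ : ℕ∞) φ) (hc : HasCompactSupport φ) :
    MemLp (fun z => φ z - ε * lap φ z) 2 volume := by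
  refine Continuous.memLp_of_hasCompactSupport ?_ ?_
  · exact h.continuous.sub (continuous_const.mul (contDiff_lap h).continuous)
  · exact hc.sub ((hcs_lap hc).mul_left (f := fun _ => ε))

lemma lap_shift (φ : E2 → ℝ) (y x : E2) : lap (fun z => φ (z + y)) x = lap φ (x + y) := by
  have h : ∀ (i : Fin 2) (f : E2 → ℝ), pd i (fun z => f (z + y)) = fun z => pd i f (z + y) := by
    intro i f; ext z
    simp only [pd]
    rw [fderiv_comp_add_right]
  simp [lap, h]

lemma uniq_zero (μ : Measure E2) [IsProbabilityMeasure μ] (ε : ℝ) (hε : 0 ≤ ε)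
    (hμ : ∀ t, charFun μ t = ((1 / (1 + ε * ‖t‖ ^ 2) : ℝ) : ℂ))
    (u : E2 → ℝ) (hu : MemLp u 2 volume)
    (hsol : ∀ φ : E2 → ℝ, ContDiff ℝ (⊤ : ℕ∞) φ → HasCompactSupport φ →
      ∫ ξ, u ξ * (φ ξ - ε * lap φ ξ) = 0) : ∀ᵐ x, u x = 0 := by
  refine ae_eq_zero_of_integral_contDiff_smul_eq_zero (hu.locallyIntegrable (by norm_num)) ?_
  intro φ h hc
  have hg := memLp_g ε h hc
  have h1 : ∫ x, φ x • u x = ∫ x, u x * ∫ y, (φ (x + y) - ε * lap φ (x + y)) ∂μ := by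
    refine integral_congr_ae (Filter.Eventually.of_forall fun x => ?_)
    simp only
    rw [key μ ε hε hμ φ h hc x, smul_eq_mul, mul_comm]
  rw [h1]
  simp_rw [← integral_const_mul]
  rw [integral_integral_swap (pair_int μ hu hg)]
  have h2 : ∀ y, ∫ x, u x * (φ (x + y) - ε * lap φ (x + y)) = 0 := by
    intro y
    have := hsol (fun z => φ (z + y)) (h.comp (contDiff_id.add contDiff_const))
      (hc.comp_homeomorph (Homeomorph.addRight y))
    simpa only [lap_shift] using this
  simp [h2]

def muEps (ε : ℝ) : Measure E2 := muOne.map (√ε • ·)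

instance (ε : ℝ) : IsProbabilityMeasure (muEps ε) :=
  Measure.isProbabilityMeasure_map (Measurable.aemeasurable (by fun_prop))

lemma charFun_muEps (ε : ℝ) (hε : 0 ≤ ε) (t : E2) :
    charFun (muEps ε) t = ((1 / (1 + ε * ‖t‖ ^ 2) : ℝ) : ℂ) := by
  rw [muEps, charFun_map_smul, charFun_muOne, norm_smul, mul_pow, Real.norm_eq_abs, sq_abs,
    Real.sq_sqrt hε]

lemma muEps_moment (m ε c : ℝ) (hm : 0 ≤ m) (hε : 0 ≤ ε) (hc : ε ≤ c) :
    ∫⁻ y, ENNReal.ofReal ((1 + ‖y‖ ^ 2) ^ m) ∂(muEps ε) ≤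
      ∫⁻ y, ENNReal.ofReal ((1 + c * ‖y‖ ^ 2) ^ m) ∂muOne := by
  rw [muEps, lintegral_map (by fun_prop) (by fun_prop)]
  refine lintegral_mono fun y => ENNReal.ofReal_le_ofReal ?_
  rw [norm_smul, mul_pow, Real.norm_eq_abs, sq_abs, Real.sq_sqrt hε]
  gcongr

/-- Theorem 5.2: unique solvability of the scaled Helmholtz equation in `L²(m)`,
with a bound uniform in `τ ≥ 0` and `w`. -/
theorem scaled_helmholtz_existence_uniqueness (m α : ℝ) (hm : 0 ≤ m) (hα : 0 < α) :
    ∃ C : ℝ, 0 < C ∧ ∀ τ : ℝ, 0 ≤ τ → ∀ w : E2 → ℝ, Measurable w → wnorm m w < ⊤ →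
      ∃ ω : E2 → ℝ, Measurable ω ∧ wnorm m ω < ⊤ ∧
        SolvesScaledHelmholtz α τ ω w ∧
        wnorm m ω ≤ ENNReal.ofReal C * wnorm m w ∧
        ∀ ω' : E2 → ℝ, Measurable ω' → wnorm m ω' < ⊤ →
          SolvesScaledHelmholtz α τ ω' w → ω' =ᵐ[volume] ω := by
  set M := ENNReal.ofReal (2 ^ m) * ∫⁻ y, ENNReal.ofReal ((1 + α ^ 2 * ‖y‖ ^ 2) ^ m) ∂muOne with hM
  have hMtop : M ≠ ⊤ :=
    ENNReal.mul_ne_top ENNReal.ofReal_ne_top (muOne_moment m (α ^ 2) (by positivity)).ne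
  have hM2 : M ^ (1 / 2 : ℝ) ≠ ⊤ := ENNReal.rpow_ne_top_of_nonneg (by norm_num) hMtop
  refine ⟨(M ^ (1 / 2 : ℝ)).toReal + 1, by positivity, ?_⟩
  intro τ hτ w hw hwn
  set ε := α ^ 2 * Real.exp (-τ) with hεdef
  have hε : 0 ≤ ε := by positivity
  have hεα : ε ≤ α ^ 2 := mul_le_of_le_one_right (by positivity) (by simpa using hτ)
  have hμ := charFun_muEps ε hε
  have hwL := memLp_of_W hm hw (wnorm_lt_top.1 hwn)
  have hωm : Measurable (fun x => ∫ y, w (x - y) ∂(muEps ε)) := by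
    have : StronglyMeasurable (Function.uncurry fun x y : E2 => w (x - y)) :=
      Measurable.stronglyMeasurable (by fun_prop)
    exact this.integral_prod_right.measurable
  have hbound : wnorm m (fun x => ∫ y, w (x - y) ∂(muEps ε)) ≤
      ENNReal.ofReal ((M ^ (1 / 2 : ℝ)).toReal + 1) * wnorm m w := by
    calc wnorm m (fun x => ∫ y, w (x - y) ∂(muEps ε))
        ≤ (M * W m w) ^ (1 / 2 : ℝ) := by
          rw [wnorm_eq]
          refine ENNReal.rpow_le_rpow ((W_conv m hm (muEps ε) w hw).trans ?_) (by norm_num)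
          rw [hM]
          exact mul_le_mul_left (mul_le_mul_right (muEps_moment m ε (α ^ 2) hm hε hεα) _) _
      _ = M ^ (1 / 2 : ℝ) * wnorm m w := by
          rw [ENNReal.mul_rpow_of_nonneg _ _ (by norm_num), wnorm_eq]
      _ ≤ _ := by
          gcongr
          rw [ENNReal.le_ofReal_iff_toReal_le hM2 (by positivity)]
          linarith
  have hfin : wnorm m (fun x => ∫ y, w (x - y) ∂(muEps ε)) < ⊤ :=
    hbound.trans_lt (ENNReal.mul_lt_top ENNReal.ofReal_lt_top hwn)
  have hsolve : SolvesScaledHelmholtz α τ (fun x => ∫ y, w (x - y) ∂(muEps ε)) w := by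
    intro φ h hc
    rw [← hεdef]
    rw [conv_pair (muEps ε) hwL (memLp_g ε h hc)]
    simp_rw [key (muEps ε) ε hε hμ φ h hc]
  refine ⟨_, hωm, hfin, hsolve, hbound, ?_⟩
  intro ω' hω'm hω'fin hω'
  have hL := memLp_of_W hm hωm (wnorm_lt_top.1 hfin)
  have hL' := memLp_of_W hm hω'm (wnorm_lt_top.1 hω'fin)
  have := uniq_zero (muEps ε) ε hε hμ _ (hL'.sub hL) (by
    intro φ h hc
    have hg := memLp_g ε h hc
    have e1 := hω' φ h hc
    have e2 := hsolve φ h hc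
    simp only [Pi.sub_apply, sub_mul]
    refine (integral_sub (hL'.integrable_mul hg) (hL.integrable_mul hg)).trans ?_
    rw [← hεdef] at e1 e2
    exact sub_eq_zero.2 (e1.trans e2.symm))
  filter_upwards [this] with x hx
  exact sub_eq_zero.1 hx
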